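/- There is an absolute constant C > 0 such that for every N ≥ 2, the incidence matrix D₂ of the N×N two-dimensional grid graph on n = N² vertices has inverse scaling factor ρ(D₂) ≤ C·√(log n); that is, every column s_j of the Moore–Penrose pseudoinverse D₂† satisfies ‖s_j‖₂ ≤ C·√(log n). -/

import Mathlib

open MeasureTheory ProbabilityTheory Matrix

noncomputable section

/-- Euclidean norm of a finitely indexed real vector. -/
def norm2 {V : Type*} [Fintype V] (θ : V → ℝ) : ℝ := Real.sqrt (∑ i, θ i ^ 2)

/-- Euclidean norm of the `j`-th column of `S`. -/
def colNorm {V E : Type*} [Fintype V] (S : Matrix V E ℝ) (j : E) : ℝ :=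
  Real.sqrt (∑ i, S i j ^ 2)

/-- `D` is an (oriented) edge–vertex incidence matrix of the simple graph `G`:
each row has a `1` and a `-1` at the endpoints of an edge of `G` and `0` elsewhere,
and each edge of `G` corresponds to exactly one row. -/
def IsIncidence {V E : Type*} (G : SimpleGraph V) (D : Matrix E V ℝ) : Prop :=
  (∀ e : E, ∃ i j : V, G.Adj i j ∧ D e i = 1 ∧ D e j = -1 ∧
      ∀ k : V, k ≠ i → k ≠ j → D e k = 0) ∧
  (∀ i j : V, G.Adj i j →
      ∃! e : E, (D e i = 1 ∧ D e j = -1) ∨ (D e i = -1 ∧ D e j = 1))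

/-- `S` is the Moore–Penrose pseudoinverse of `D`. -/
def IsMoorePenrose {E V : Type*} [Fintype V] [Fintype E]
    (D : Matrix E V ℝ) (S : Matrix V E ℝ) : Prop :=
  D * S * D = D ∧ S * D * S = S ∧ (D * S)ᵀ = D * S ∧ (S * D)ᵀ = S * D

/-- Inverse scaling factor: maximal column norm of the pseudoinverse `S` of `D`. -/
def invScaling {V E : Type*} [Fintype V] (S : Matrix V E ℝ) : ℝ := ⨆ j : E, colNorm S j

/-- Compatibility factor `κ_T(D)`. -/
def compat {V E : Type*} [Fintype V] [Fintype E] [DecidableEq E]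
    (D : Matrix E V ℝ) (T : Finset E) : ℝ :=
  if T = ∅ then 1
  else sInf {r : ℝ | ∃ θ : V → ℝ, (∑ e ∈ T, |D.mulVec θ e|) ≠ 0 ∧
    r = Real.sqrt T.card * norm2 θ / ∑ e ∈ T, |D.mulVec θ e|}

/-- `θhat` is a TV denoiser with data `y` and regularization `lam`,
i.e. a minimizer of the TV-penalized least squares criterion. -/
def IsTVDenoiser {V E : Type*} [Fintype V] [Fintype E]
    (D : Matrix E V ℝ) (lam : ℝ) (y θhat : V → ℝ) : Prop :=
  ∀ θ : V → ℝ,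
    (1 / (Fintype.card V : ℝ)) * ∑ i, (θhat i - y i) ^ 2 + lam * ∑ e, |D.mulVec θhat e|
      ≤ (1 / (Fintype.card V : ℝ)) * ∑ i, (θ i - y i) ^ 2 + lam * ∑ e, |D.mulVec θ e|

/-- The law of the noise vector `ε`: independent centered Gaussian coordinates
with variance `σ²`. -/
def noise (V : Type*) [Fintype V] (σ : ℝ) : Measure (V → ℝ) :=
  Measure.pi fun _ => gaussianReal 0 (σ ^ 2).toNNReal

/-- Number of nonzero coordinates. -/
def supp0 {E : Type*} [Fintype E] (x : E → ℝ) : ℕ :=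
  (Finset.univ.filter fun e => x e ≠ 0).card

/-- The N×N two-dimensional grid graph. -/
def gridGraph2 (N : ℕ) : SimpleGraph (Fin N × Fin N) :=
  SimpleGraph.fromRel fun a b =>
    (a.1 = b.1 ∧ (a.2 : ℕ) + 1 = (b.2 : ℕ)) ∨ (a.2 = b.2 ∧ (a.1 : ℕ) + 1 = (b.1 : ℕ))

/-- The d-dimensional N×⋯×N grid graph. -/
def gridGraphD (d N : ℕ) : SimpleGraph (Fin d → Fin N) :=
  SimpleGraph.fromRel fun a b =>
    ∃ j : Fin d, ((a j : ℕ) + 1 = (b j : ℕ)) ∧ ∀ k : Fin d, k ≠ j → a k = b k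

/-- The d-dimensional hypercube graph. -/
def cubeGraph (d : ℕ) : SimpleGraph (Fin d → Bool) :=
  SimpleGraph.fromRel fun a b =>
    ∃ j : Fin d, a j ≠ b j ∧ ∀ k : Fin d, k ≠ j → a k = b k

/-- The k-th power of the cycle graph on n vertices. -/
def cyclePowerGraph (n k : ℕ) : SimpleGraph (Fin n) :=
  SimpleGraph.fromRel fun a b =>
    ∃ l : ℕ, 1 ≤ l ∧ l ≤ k ∧ (b : ℕ) = ((a : ℕ) + l) % n

/-! ### Moore–Penrose identities -/

section MoorePenrose

variable {V E : Type*} [Fintype V] [Fintype E] {D : Matrix E V ℝ} {S : Matrix V E ℝ}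

lemma IsMoorePenrose.transpose_mul_mul (h : IsMoorePenrose D S) : Dᵀ * D * S = Dᵀ := by
  obtain ⟨h1, -, h3, -⟩ := h
  rw [Matrix.mul_assoc, ← h3, ← Matrix.transpose_mul, h1]

/-- A left eigenvector relation passes to the columns of the pseudoinverse. -/
lemma IsMoorePenrose.mul_inner_eq (h : IsMoorePenrose D S) {φ : V → ℝ} {μ : ℝ}
    (hφ : (Dᵀ * D) *ᵥ φ = μ • φ) (j : E) : μ * ∑ v, φ v * S v j = (D *ᵥ φ) j := by
  have hsym : (Dᵀ * D)ᵀ = Dᵀ * D := by simp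
  have h1 : φ ᵥ* (Dᵀ * D * S) = μ • (φ ᵥ* S) := by
    rw [← Matrix.vecMul_vecMul, ← Matrix.mulVec_transpose (Dᵀ * D), hsym, hφ, Matrix.smul_vecMul]
  rw [h.transpose_mul_mul, Matrix.vecMul_transpose] at h1
  simpa [Matrix.vecMul, dotProduct] using (congrFun h1 j).symm

/-- The columns of the pseudoinverse are orthogonal to the kernel. -/
lemma IsMoorePenrose.inner_eq_zero (h : IsMoorePenrose D S) {φ : V → ℝ}
    (hφ : D *ᵥ φ = 0) (j : E) : ∑ v, φ v * S v j = 0 := by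
  obtain ⟨-, h2, -, h4⟩ := h
  have h1 : φ ᵥ* S = 0 := by
    rw [← h2, ← Matrix.vecMul_vecMul, ← h4, Matrix.vecMul_transpose, ← Matrix.mulVec_mulVec, hφ]
    simp
  simpa [Matrix.vecMul, dotProduct] using congrFun h1 j

end MoorePenrose

/-! ### The Laplacian of an incidence matrix -/

section Laplacian

variable {V E : Type*} {G : SimpleGraph V} {D : Matrix E V ℝ}

lemma IsIncidence.exists_mulVec_eq [Fintype V] [DecidableEq V] (h : IsIncidence G D) (e : E) :
    ∃ i j, G.Adj i j ∧ ∀ φ : V → ℝ, (D *ᵥ φ) e = φ i - φ j := by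
  obtain ⟨i, j, hij, h1, h2, h0⟩ := h.1 e
  refine ⟨i, j, hij, fun φ => ?_⟩
  have hD : ∀ k, D e k = (if k = i then 1 else 0) - if k = j then 1 else 0 := by
    intro k
    have := hij.ne
    by_cases hi : k = i
    · subst hi; simp [h1, this]
    · by_cases hj : k = j
      · subst hj; simp [h2, hi]
      · simp [hi, hj, h0 k hi hj]
  simp [Matrix.mulVec, dotProduct, hD, sub_mul, Finset.sum_sub_distrib]

lemma IsIncidence.mulVec_one [Fintype V] [DecidableEq V] (h : IsIncidence G D) : D *ᵥ (fun _ => (1 : ℝ)) = 0 := by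
  ext e
  obtain ⟨i, j, -, hφ⟩ := h.exists_mulVec_eq e
  simp [hφ]

lemma IsIncidence.transpose_mul_apply [Fintype E] [DecidableRel G.Adj]
    (h : IsIncidence G D) {v w : V} (hvw : v ≠ w) : (Dᵀ * D) v w = if G.Adj v w then -1 else 0 := by
  have key : ∀ e, D e v * D e w ≠ 0 → G.Adj v w ∧
      ((D e v = 1 ∧ D e w = -1) ∨ (D e v = -1 ∧ D e w = 1)) := by
    intro e he
    obtain ⟨i, j, hij, h1, h2, h0⟩ := h.1 e
    have hv := left_ne_zero_of_mul he
    have hw := right_ne_zero_of_mul he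
    have hv' : v = i ∨ v = j := by
      by_contra! hc
      exact hv (h0 v hc.1 hc.2)
    have hw' : w = i ∨ w = j := by
      by_contra! hc
      exact hw (h0 w hc.1 hc.2)
    rcases hv' with rfl | rfl <;> rcases hw' with rfl | rfl
    · exact absurd rfl hvw
    · exact ⟨hij, Or.inl ⟨h1, h2⟩⟩
    · exact ⟨hij.symm, Or.inr ⟨h2, h1⟩⟩
    · exact absurd rfl hvw
  simp only [Matrix.mul_apply, Matrix.transpose_apply]
  split_ifs with hadj
  · obtain ⟨e, he, hu⟩ := h.2 v w hadj
    rw [Finset.sum_eq_single e]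
    · rcases he with ⟨h1, h2⟩ | ⟨h1, h2⟩ <;> simp [h1, h2]
    · intro e' _ hne
      by_contra hc
      exact hne (hu e' (key e' hc).2)
    · simp
  · exact Finset.sum_eq_zero fun e _ => by
      by_contra hc
      exact hadj (key e hc).1

lemma IsIncidence.transpose_mul_mulVec [Fintype V] [DecidableEq V] [Fintype E]
    [DecidableRel G.Adj] (h : IsIncidence G D) (φ : V → ℝ) (v : V) :
    ((Dᵀ * D) *ᵥ φ) v = ∑ w, if G.Adj v w then φ v - φ w else 0 := by
  have h1 : ∑ w, (Dᵀ * D) v w = 0 := by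
    have : ((Dᵀ * D) *ᵥ fun _ => (1 : ℝ)) v = 0 := by
      rw [← Matrix.mulVec_mulVec, h.mulVec_one]; simp
    simpa [Matrix.mulVec, dotProduct] using this
  have h2 : ((Dᵀ * D) *ᵥ φ) v = ∑ w, (Dᵀ * D) v w * (φ w - φ v) := by
    simp only [mul_sub, Finset.sum_sub_distrib, ← Finset.sum_mul, h1, zero_mul, sub_zero]
    rfl
  rw [h2]
  refine Finset.sum_congr rfl fun w _ => ?_
  by_cases hvw : v = w
  · subst hvw; simp
  · rw [h.transpose_mul_apply hvw]
    split_ifs <;> ring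

end Laplacian

/-! ### Parseval's identity -/

/-- Parseval's identity for a complete orthogonal system, with weights `w`. -/
lemma sum_weight_mul_inner_sq {ι : Type*} [Fintype ι] [DecidableEq ι] (Φ : ι → ι → ℝ) (w : ι → ℝ)
    (h : ∀ k k', w k * ∑ x, Φ k x * Φ k' x = if k = k' then 1 else 0) (s : ι → ℝ) :
    ∑ k, w k * (∑ x, Φ k x * s x) ^ 2 = ∑ x, s x ^ 2 := by
  let A : Matrix ι ι ℝ := Matrix.of fun k x => w k * Φ k x
  let B : Matrix ι ι ℝ := Matrix.of fun x k => Φ k x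
  have hAB : A * B = 1 := by
    ext k k'
    simp only [Matrix.mul_apply, A, B, Matrix.of_apply, Matrix.one_apply, ← h, Finset.mul_sum,
      mul_assoc]
  have hBA : B * A = 1 := mul_eq_one_comm.mp hAB
  have h1 : ∑ k, w k * (∑ x, Φ k x * s x) ^ 2 = (s ᵥ* B) ⬝ᵥ (A *ᵥ s) := by
    simp only [dotProduct, Matrix.vecMul, Matrix.mulVec, A, B, Matrix.of_apply]
    refine Finset.sum_congr rfl fun k _ => ?_
    simp only [mul_assoc, ← Finset.mul_sum, mul_comm (s _)]
    ring
  rw [h1, ← Matrix.dotProduct_mulVec, Matrix.mulVec_mulVec, hBA, Matrix.one_mulVec]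
  simp [dotProduct, sq]

/-! ### The discrete cosine basis of the path -/

/-- Half of the frequency of the `k`-th Neumann eigenvector of the path on `N` vertices. -/
def pathFreq (N k : ℕ) : ℝ := Real.pi * k / (2 * N)

/-- The `k`-th Neumann eigenvector of the path on `N` vertices, as a function on the line. -/
def pathCos (N k : ℕ) (t : ℝ) : ℝ := Real.cos (pathFreq N k * (2 * t + 1))

/-- The `k`-th eigenvalue of the Laplacian of the path on `N` vertices. -/
def pathEigenvalue (N k : ℕ) : ℝ := 4 * Real.sin (pathFreq N k) ^ 2

/-- The inverse squared norm of the `k`-th eigenvector of the path on `N` vertices. -/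
def pathWeight (N k : ℕ) : ℝ := if k = 0 then 1 / N else 2 / N

lemma pathWeight_nonneg (N k : ℕ) : 0 ≤ pathWeight N k := by
  unfold pathWeight; split_ifs <;> positivity

lemma pathWeight_le (N k : ℕ) : pathWeight N k ≤ 2 / N := by
  unfold pathWeight; split_ifs
  · gcongr; norm_num
  · rfl

lemma sum_cos_odd_mul (θ : ℝ) (n : ℕ) :
    (∑ x ∈ Finset.range n, Real.cos (θ * (2 * x + 1))) * (2 * Real.sin θ)
      = Real.sin (2 * n * θ) := by
  induction n with
  | zero => simp
  | succ n ih =>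
    rw [Finset.sum_range_succ, add_mul, ih]
    have h1 : 2 * (n : ℝ) * θ = θ * (2 * n + 1) - θ := by ring
    have h2 : 2 * ((n + 1 : ℕ) : ℝ) * θ = θ * (2 * n + 1) + θ := by push_cast; ring
    rw [h1, h2, Real.sin_sub, Real.sin_add]
    ring

lemma sum_pathCos {N m : ℕ} (hm : 0 < m) (hmN : m < 2 * N) :
    ∑ x ∈ Finset.range N, pathCos N m x = 0 := by
  have hN : (0 : ℝ) < N := by exact_mod_cast (by omega : 0 < N)
  have hm' : (0 : ℝ) < m := by exact_mod_cast hm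
  have hmN' : (m : ℝ) < 2 * N := by exact_mod_cast hmN
  have hpos : 0 < Real.sin (pathFreq N m) := by
    apply Real.sin_pos_of_pos_of_lt_pi
    · unfold pathFreq; positivity
    · unfold pathFreq
      rw [div_lt_iff₀ (by positivity)]
      exact mul_lt_mul_of_pos_left hmN' Real.pi_pos
  have h := sum_cos_odd_mul (pathFreq N m) N
  have h2 : 2 * (N : ℝ) * pathFreq N m = m * Real.pi := by
    unfold pathFreq; field_simp
  rw [h2, Real.sin_nat_mul_pi] at h
  exact (mul_eq_zero.mp h).resolve_right (by positivity)

lemma pathCos_mul_of_le {N k l : ℕ} (h : l ≤ k) (t : ℝ) :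
    pathCos N k t * pathCos N l t = (pathCos N (k - l) t + pathCos N (k + l) t) / 2 := by
  have h1 : pathFreq N (k - l) * (2 * t + 1)
      = pathFreq N k * (2 * t + 1) - pathFreq N l * (2 * t + 1) := by
    unfold pathFreq; rw [Nat.cast_sub h]; ring
  have h2 : pathFreq N (k + l) * (2 * t + 1)
      = pathFreq N k * (2 * t + 1) + pathFreq N l * (2 * t + 1) := by
    unfold pathFreq; push_cast; ring
  unfold pathCos
  rw [h1, h2, Real.cos_sub, Real.cos_add]
  ring

lemma sum_pathCos_zero (N : ℕ) : ∑ x ∈ Finset.range N, pathCos N 0 x = N := by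
  simp [pathCos, pathFreq]

lemma pathWeight_mul_sum_of_le {N k l : ℕ} (h : l ≤ k) (hk : k < N) :
    pathWeight N k * ∑ x ∈ Finset.range N, pathCos N k x * pathCos N l x
      = if k = l then 1 else 0 := by
  have hN : (N : ℝ) ≠ 0 := by exact_mod_cast (by omega : N ≠ 0)
  simp only [pathCos_mul_of_le h, ← Finset.sum_div, Finset.sum_add_distrib]
  rcases h.eq_or_lt with rfl | hlt
  · rcases Nat.eq_zero_or_pos l with rfl | hl
    · simp [sum_pathCos_zero, pathWeight, hN]
    · rw [sum_pathCos (m := l + l) (by omega) (by omega), Nat.sub_self, sum_pathCos_zero]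
      simp only [pathWeight, hl.ne', if_true, if_false]
      field_simp
      ring
  · rw [sum_pathCos (m := k - l) (by omega) (by omega),
      sum_pathCos (m := k + l) (by omega) (by omega)]
    simp [hlt.ne']

lemma pathWeight_mul_sum {N k l : ℕ} (hk : k < N) (hl : l < N) :
    pathWeight N k * ∑ x ∈ Finset.range N, pathCos N k x * pathCos N l x
      = if k = l then 1 else 0 := by
  rcases le_total l k with h | h
  · exact pathWeight_mul_sum_of_le h hk
  · rcases h.eq_or_lt with rfl | hlt
    · exact pathWeight_mul_sum_of_le le_rfl hk
    · have h0 := pathWeight_mul_sum_of_le h hl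
      rw [if_neg hlt.ne'] at h0
      have hw : pathWeight N l ≠ 0 := by
        have : (N : ℝ) ≠ 0 := by exact_mod_cast (by omega : N ≠ 0)
        simp only [pathWeight]; split_ifs <;> positivity
      rw [if_neg hlt.ne]
      simp only [mul_comm (pathCos N k _)]
      rw [(mul_eq_zero.mp h0).resolve_left hw, mul_zero]

lemma pathCos_sub_pathCos (N k : ℕ) (t : ℝ) :
    pathCos N k t - pathCos N k (t + 1)
      = 2 * Real.sin (pathFreq N k) * Real.sin (pathFreq N k * (2 * t + 2)) := by
  have h1 : pathFreq N k * (2 * t + 1) = pathFreq N k * (2 * t + 2) - pathFreq N k := by ring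
  have h2 : pathFreq N k * (2 * (t + 1) + 1)
      = pathFreq N k * (2 * t + 2) + pathFreq N k := by ring
  unfold pathCos
  rw [h1, h2, Real.cos_sub, Real.cos_add]
  ring

lemma pathCos_sub_sq_le (N k : ℕ) (t : ℝ) :
    (pathCos N k t - pathCos N k (t + 1)) ^ 2 ≤ pathEigenvalue N k := by
  rw [pathCos_sub_pathCos, mul_pow, mul_pow, pathEigenvalue]
  have := Real.sin_sq_le_one (pathFreq N k * (2 * t + 2))
  nlinarith [sq_nonneg (Real.sin (pathFreq N k))]

lemma pathCos_second_difference (N k : ℕ) (t : ℝ) :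
    (pathCos N k t - pathCos N k (t + 1)) + (pathCos N k t - pathCos N k (t - 1))
      = pathEigenvalue N k * pathCos N k t := by
  have h1 : pathFreq N k * (2 * (t + 1) + 1)
      = pathFreq N k * (2 * t + 1) + 2 * pathFreq N k := by ring
  have h2 : pathFreq N k * (2 * (t - 1) + 1)
      = pathFreq N k * (2 * t + 1) - 2 * pathFreq N k := by ring
  unfold pathCos pathEigenvalue
  rw [h1, h2, Real.cos_sub, Real.cos_add, Real.cos_two_mul, Real.sin_sq]
  ring

lemma pathCos_neg_one (N k : ℕ) : pathCos N k (0 - 1) = pathCos N k 0 := by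
  unfold pathCos
  rw [← Real.cos_neg]
  congr 1; ring

lemma pathCos_last {N k : ℕ} {x : ℕ} (hx : x + 1 = N) :
    pathCos N k ((x : ℝ) + 1) = pathCos N k x := by
  have h : pathCos N k x - pathCos N k (x + 1) = 0 := by
    rw [pathCos_sub_pathCos]
    have : pathFreq N k * (2 * x + 2) = k * Real.pi := by
      have hN : (N : ℝ) ≠ 0 := by exact_mod_cast (by omega : N ≠ 0)
      have : (2 * (x : ℝ) + 2) = 2 * N := by rw [← hx]; push_cast; ring
      rw [this, pathFreq]; field_simp
    rw [this, Real.sin_nat_mul_pi, mul_zero]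
  linarith

/-- `pathCos N k` is a Laplacian eigenvector of the path on `N` vertices. -/
lemma path_laplacian_pathCos {N : ℕ} (k : ℕ) (x : Fin N) :
    (∑ x' : Fin N, if (x : ℕ) + 1 = x' ∨ (x' : ℕ) + 1 = x then
        pathCos N k (x : ℕ) - pathCos N k (x' : ℕ) else 0)
      = pathEigenvalue N k * pathCos N k (x : ℕ) := by
  have hsplit : ∀ x' : Fin N, (if (x : ℕ) + 1 = x' ∨ (x' : ℕ) + 1 = x then
        pathCos N k (x : ℕ) - pathCos N k (x' : ℕ) else 0)
      = (if (x : ℕ) + 1 = x' then pathCos N k (x : ℕ) - pathCos N k (x' : ℕ) else 0)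
        + if (x' : ℕ) + 1 = x then pathCos N k (x : ℕ) - pathCos N k (x' : ℕ) else 0 := by
    intro x'
    by_cases h1 : (x : ℕ) + 1 = x'
    · have h2 : ¬ (x' : ℕ) + 1 = x := by omega
      simp [h1, h2]
    · simp [h1]
  simp only [hsplit, Finset.sum_add_distrib]
  rw [← pathCos_second_difference]
  congr 1
  · by_cases h : (x : ℕ) + 1 < N
    · rw [Finset.sum_eq_single ⟨(x : ℕ) + 1, h⟩]
      · simp
      · intro b _ hb
        exact if_neg fun hc => hb (Fin.ext hc.symm)
      · simp
    · rw [pathCos_last (by omega), sub_self]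
      exact Finset.sum_eq_zero fun b _ => if_neg (by omega)
  · by_cases h : (x : ℕ) = 0
    · rw [h, Nat.cast_zero, pathCos_neg_one, sub_self]
      exact Finset.sum_eq_zero fun b _ => if_neg (by omega)
    · rw [Finset.sum_eq_single ⟨(x : ℕ) - 1, by omega⟩]
      · rw [if_pos (by simp; omega)]
        simp [Nat.cast_sub (by omega : 1 ≤ (x : ℕ))]
      · intro b _ hb
        exact if_neg fun hc => hb (Fin.ext (by simp; omega))
      · simp

lemma le_pathEigenvalue {N k : ℕ} (hk : k < N) :
    4 * (k : ℝ) ^ 2 / (N : ℝ) ^ 2 ≤ pathEigenvalue N k := by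
  have hN : (0 : ℝ) < N := by exact_mod_cast (by omega : 0 < N)
  have hk' : (k : ℝ) ≤ N := by exact_mod_cast hk.le
  have h := Real.mul_le_sin (x := pathFreq N k) (by unfold pathFreq; positivity) (by
    unfold pathFreq
    rw [div_le_div_iff₀ (by positivity) (by positivity)]
    nlinarith [Real.pi_pos])
  have h2 : 2 / Real.pi * pathFreq N k = k / N := by
    unfold pathFreq; field_simp
  rw [h2] at h
  have h3 : ((k : ℝ) / N) ^ 2 ≤ Real.sin (pathFreq N k) ^ 2 := by gcongr
  rw [div_pow] at h3
  unfold pathEigenvalue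
  rw [mul_div_assoc]
  linarith

/-! ### The cosine basis of the grid -/

/-- The `(k, l)`-th Laplacian eigenvector of the grid. -/
def gridCos (N : ℕ) (k v : Fin N × Fin N) : ℝ :=
  pathCos N k.1 (v.1 : ℕ) * pathCos N k.2 (v.2 : ℕ)

lemma gridCos_orthogonal {N : ℕ} (k k' : Fin N × Fin N) :
    pathWeight N k.1 * pathWeight N k.2 * ∑ v, gridCos N k v * gridCos N k' v
      = if k = k' then 1 else 0 := by
  have h : ∑ v, gridCos N k v * gridCos N k' v
      = (∑ x ∈ Finset.range N, pathCos N k.1 x * pathCos N k'.1 x)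
        * ∑ y ∈ Finset.range N, pathCos N k.2 y * pathCos N k'.2 y := by
    rw [Finset.sum_range, Finset.sum_range, Finset.sum_mul_sum, Fintype.sum_prod_type]
    refine Finset.sum_congr rfl fun x _ => Finset.sum_congr rfl fun y _ => ?_
    simp only [gridCos]; ring
  rw [h, mul_mul_mul_comm, pathWeight_mul_sum k.1.2 k'.1.2, pathWeight_mul_sum k.2.2 k'.2.2]
  by_cases h1 : k.1 = k'.1 <;> by_cases h2 : k.2 = k'.2 <;>
    simp [h1, h2, Prod.ext_iff, Fin.val_inj]

lemma gridGraph2_adj_iff {N : ℕ} (v w : Fin N × Fin N) :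
    (gridGraph2 N).Adj v w ↔
      (v.1 = w.1 ∧ ((v.2 : ℕ) + 1 = w.2 ∨ (w.2 : ℕ) + 1 = v.2)) ∨
      (v.2 = w.2 ∧ ((v.1 : ℕ) + 1 = w.1 ∨ (w.1 : ℕ) + 1 = v.1)) := by
  simp only [gridGraph2, SimpleGraph.fromRel_adj, ne_eq, Prod.ext_iff, Fin.ext_iff]
  omega

open Classical in
lemma gridCos_laplacian {N : ℕ} (k v : Fin N × Fin N) :
    (∑ w, if (gridGraph2 N).Adj v w then gridCos N k v - gridCos N k w else 0)
      = (pathEigenvalue N k.1 + pathEigenvalue N k.2) * gridCos N k v := by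
  obtain ⟨x, y⟩ := v
  have hsplit : ∀ w : Fin N × Fin N,
      (if (gridGraph2 N).Adj (x, y) w then gridCos N k (x, y) - gridCos N k w else 0)
      = (if y = w.2 then (if (x : ℕ) + 1 = w.1 ∨ (w.1 : ℕ) + 1 = x then
          pathCos N k.1 (x : ℕ) - pathCos N k.1 (w.1 : ℕ) else 0) * pathCos N k.2 (y : ℕ) else 0)
        + if x = w.1 then (if (y : ℕ) + 1 = w.2 ∨ (w.2 : ℕ) + 1 = y then
          pathCos N k.2 (y : ℕ) - pathCos N k.2 (w.2 : ℕ) else 0) * pathCos N k.1 (x : ℕ)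
          else 0 := by
    rintro ⟨x', y'⟩
    rw [gridGraph2_adj_iff]
    by_cases hx : x = x'
    · subst hx
      by_cases hy : y = y'
      · subst hy; simp
      · simp only [hy, true_and, false_and, or_false, if_true, if_false, zero_add, gridCos]
        split_ifs <;> ring
    · by_cases hy : y = y'
      · subst hy
        simp only [hx, true_and, false_and, false_or, if_true, if_false, add_zero, gridCos]
        split_ifs <;> ring
      · simp [hx, hy]
  simp only [hsplit, Finset.sum_add_distrib, Fintype.sum_prod_type]
  rw [Finset.sum_comm (f := fun a b => if x = a then _ else _)]
  simp only [Finset.sum_ite_eq, Finset.mem_univ, if_true, ← Finset.sum_mul,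
    path_laplacian_pathCos, gridCos]
  ring

lemma gridCos_sub_sq_le {N : ℕ} (k : Fin N × Fin N) {v w : Fin N × Fin N}
    (h : (gridGraph2 N).Adj v w) :
    (gridCos N k v - gridCos N k w) ^ 2 ≤ pathEigenvalue N k.1 + pathEigenvalue N k.2 := by
  have step : ∀ (i : ℕ) (a b : Fin N), ((a : ℕ) + 1 = b ∨ (b : ℕ) + 1 = a) →
      (pathCos N i (a : ℕ) - pathCos N i (b : ℕ)) ^ 2 ≤ pathEigenvalue N i := by
    rintro i a b (hab | hab)
    · rw [← hab]; push_cast; exact pathCos_sub_sq_le ..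
    · rw [← hab, ← neg_sq, neg_sub]; push_cast; exact pathCos_sub_sq_le ..
  have nonneg : ∀ i, 0 ≤ pathEigenvalue N i := fun i => by unfold pathEigenvalue; positivity
  have le_one : ∀ i t, pathCos N i t ^ 2 ≤ 1 := fun i t => Real.cos_sq_le_one _
  have n1 := nonneg k.1
  have n2 := nonneg k.2
  rcases (gridGraph2_adj_iff v w).mp h with ⟨he, hs⟩ | ⟨he, hs⟩
  · have h1 := step k.2 _ _ hs
    have h2 := le_one k.1 (w.1 : ℕ)
    simp only [gridCos, he, ← mul_sub, mul_pow]
    nlinarith [mul_le_mul h2 h1 (sq_nonneg _) zero_le_one]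
  · have h1 := step k.1 _ _ hs
    have h2 := le_one k.2 (w.2 : ℕ)
    simp only [gridCos, he, ← sub_mul, mul_pow]
    nlinarith [mul_le_mul h1 h2 (sq_nonneg _) n1]

/-! ### The lattice sum -/

lemma sum_one_div_sq_add_sq_le (n : ℕ) :
    ∑ k ∈ Finset.range (n + 1), ∑ l ∈ Finset.range (n + 1), 1 / ((k : ℝ) ^ 2 + (l : ℝ) ^ 2)
      ≤ 3 * (harmonic n : ℝ) := by
  induction n with
  | zero => simp
  | succ n ih =>
    have hn : (0 : ℝ) < (n + 1 : ℕ) := by positivity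
    have bound : ∀ k : ℕ, 1 / ((k : ℝ) ^ 2 + ((n + 1 : ℕ) : ℝ) ^ 2)
        ≤ 1 / ((n + 1 : ℕ) : ℝ) ^ 2 := fun k => by
      gcongr
      nlinarith [sq_nonneg (k : ℝ)]
    have bound' : ∀ k : ℕ, 1 / (((n + 1 : ℕ) : ℝ) ^ 2 + (k : ℝ) ^ 2)
        ≤ 1 / ((n + 1 : ℕ) : ℝ) ^ 2 := fun k => by
      rw [add_comm]; exact bound k
    rw [Finset.sum_range_succ]
    simp only [Finset.sum_range_succ _ (n + 1)]
    rw [Finset.sum_add_distrib, harmonic_succ]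
    have h1 := Finset.sum_le_card_nsmul (Finset.range (n + 1)) _ _ fun k _ => bound k
    have h2 := Finset.sum_le_card_nsmul (Finset.range (n + 1)) _ _ fun k _ => bound' k
    have h3 := bound (n + 1)
    rw [Finset.card_range, nsmul_eq_mul] at h1 h2
    have h4 : ((n + 1 : ℕ) : ℝ) * (1 / ((n + 1 : ℕ) : ℝ) ^ 2) = ((n + 1 : ℕ) : ℝ)⁻¹ := by
      field_simp
    have h5 : 1 / ((n + 1 : ℕ) : ℝ) ^ 2 ≤ ((n + 1 : ℕ) : ℝ)⁻¹ := by
      rw [← h4]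
      have : (1 : ℝ) ≤ (n + 1 : ℕ) := by norm_num
      exact le_mul_of_one_le_left (by positivity) this
    push_cast at *
    linarith

/-! ### The inverse scaling factor -/

lemma sum_sq_column_le {N m : ℕ} {D : Matrix (Fin m) (Fin N × Fin N) ℝ}
    (hD : IsIncidence (gridGraph2 N) D) {S : Matrix (Fin N × Fin N) (Fin m) ℝ}
    (hS : IsMoorePenrose D S) (j : Fin m) :
    ∑ v, S v j ^ 2
      ≤ ∑ k ∈ Finset.range N, ∑ l ∈ Finset.range N, 1 / ((k : ℝ) ^ 2 + (l : ℝ) ^ 2) := by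
  classical
  rw [← sum_weight_mul_inner_sq (gridCos N) _ gridCos_orthogonal]
  simp only [Finset.sum_range, ← Fintype.sum_prod_type
    (f := fun p : Fin N × Fin N => 1 / (((p.1 : ℕ) : ℝ) ^ 2 + ((p.2 : ℕ) : ℝ) ^ 2))]
  refine Finset.sum_le_sum fun k _ => ?_
  by_cases h0 : (k.1 : ℕ) = 0 ∧ (k.2 : ℕ) = 0
  · have hφ : D *ᵥ gridCos N k = 0 := by
      have : gridCos N k = fun _ => 1 := by
        funext v; simp [gridCos, pathCos, pathFreq, h0.1, h0.2]
      rw [this, hD.mulVec_one]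
    simp [hS.inner_eq_zero hφ, h0.1, h0.2]
  have hN : (0 : ℝ) < N := by exact_mod_cast (by omega : 0 < N)
  set q : ℝ := ((k.1 : ℕ) : ℝ) ^ 2 + ((k.2 : ℕ) : ℝ) ^ 2 with hq_def
  have hq : 0 < q := by
    rcases not_and_or.mp h0 with h | h
    · have : (0 : ℝ) < (k.1 : ℕ) := by exact_mod_cast Nat.pos_of_ne_zero h
      positivity
    · have : (0 : ℝ) < (k.2 : ℕ) := by exact_mod_cast Nat.pos_of_ne_zero h
      positivity
  set μ := pathEigenvalue N k.1 + pathEigenvalue N k.2 with hμ_def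
  have hμ : 4 * q / (N : ℝ) ^ 2 ≤ μ := by
    have := add_le_add (le_pathEigenvalue k.1.2) (le_pathEigenvalue k.2.2)
    rwa [← add_div, ← mul_add] at this
  have hμ0 : 0 < μ := lt_of_lt_of_le (by positivity) hμ
  have heig : (Dᵀ * D) *ᵥ gridCos N k = μ • gridCos N k := by
    funext v
    rw [hD.transpose_mul_mulVec, gridCos_laplacian]
    rfl
  have hc := hS.mul_inner_eq heig j
  obtain ⟨v, w, hvw, hDφ⟩ := hD.exists_mulVec_eq j
  have hsq := gridCos_sub_sq_le k hvw
  rw [← hDφ, ← hc, mul_pow, ← hμ_def] at hsq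
  set c := ∑ v, gridCos N k v * S v j
  have h1 : μ * c ^ 2 ≤ 1 := le_of_mul_le_mul_left (by linarith : μ * (μ * c ^ 2) ≤ μ * 1) hμ0
  have h2 : c ^ 2 * (4 * q / (N : ℝ) ^ 2) ≤ 1 :=
    (mul_le_mul_of_nonneg_left hμ (sq_nonneg c)).trans (by linarith)
  have hw : pathWeight N k.1 * pathWeight N k.2 ≤ 2 / N * (2 / N) :=
    mul_le_mul (pathWeight_le _ _) (pathWeight_le _ _) (pathWeight_nonneg _ _) (by positivity)
  rw [le_div_iff₀ hq]
  calc pathWeight N k.1 * pathWeight N k.2 * c ^ 2 * q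
      ≤ 2 / N * (2 / N) * c ^ 2 * q := by gcongr
    _ = c ^ 2 * (4 * q / (N : ℝ) ^ 2) := by field_simp; ring
    _ ≤ 1 := h2

/-- Proposition 3.1: the incidence matrix of the N×N 2D grid
on `n = N²` vertices has inverse scaling factor `ρ ≤ C·√(log n)`:
every column of its Moore–Penrose pseudoinverse has Euclidean norm at most
`C·√(log n)`, for an absolute constant `C > 0`. -/
theorem grid2d_inverse_scaling_factor :
    ∃ C : ℝ, 0 < C ∧ ∀ N : ℕ, 2 ≤ N →
      ∀ (m : ℕ) (D : Matrix (Fin m) (Fin N × Fin N) ℝ),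
        IsIncidence (gridGraph2 N) D →
        ∀ S : Matrix (Fin N × Fin N) (Fin m) ℝ, IsMoorePenrose D S →
          ∀ j : Fin m, colNorm S j ≤ C * Real.sqrt (Real.log ((N : ℝ) ^ 2)) := by
  refine ⟨3, by norm_num, fun N hN m D hD S hS j => ?_⟩
  obtain ⟨n, rfl⟩ : ∃ n, N = n + 1 := ⟨N - 1, by omega⟩
  have hn : 1 ≤ n := by omega
  have h1 := (sum_sq_column_le hD hS j).trans (sum_one_div_sq_add_sq_le n)
  have h2 := harmonic_le_one_add_log n
  have h3 : Real.log n ≤ Real.log (n + 1 : ℕ) :=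
    Real.log_le_log (by exact_mod_cast hn) (by norm_num)
  have h4 : Real.log 2 ≤ Real.log (n + 1 : ℕ) :=
    Real.log_le_log (by norm_num) (by exact_mod_cast hN)
  have h5 := Real.log_two_gt_d9
  have h6 : ∑ v, S v j ^ 2 ≤ 3 ^ 2 * Real.log (((n + 1 : ℕ) : ℝ) ^ 2) := by
    rw [Real.log_pow]
    push_cast at *
    linarith
  unfold colNorm
  calc Real.sqrt (∑ v, S v j ^ 2)
      ≤ Real.sqrt (3 ^ 2 * Real.log (((n + 1 : ℕ) : ℝ) ^ 2)) := Real.sqrt_le_sqrt h6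
    _ = 3 * Real.sqrt (Real.log (((n + 1 : ℕ) : ℝ) ^ 2)) := by
      rw [Real.sqrt_mul (by norm_num), Real.sqrt_sq (by norm_num)]
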